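/- Let G be a finite simple graph with minimum degree δ ≥ 1 and maximum degree Δ. Then the zero forcing number satisfies Z(G) = F_1(G) ≤ Δ·n / (Δ + 1), where n is the number of vertices of G. -/

import Mathlib

open Finset SimpleGraph

/-- One round of the `k`-forcing color change rule: to the currently colored set `C` we add
every vertex `w` having a colored neighbor `v` with at most `k` non-colored neighbors. -/
def kForceStep {V : Type*} [Fintype V] [DecidableEq V] (G : SimpleGraph V)
    [DecidableRel G.Adj] (k : ℕ) (C : Finset V) : Finset V :=
  C ∪ Finset.univ.filter (fun w =>
    ∃ v ∈ C, G.Adj v w ∧ ((G.neighborFinset v) \ C).card ≤ k)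

/-- `S` is a `k`-forcing set: iterating the color change rule starting from `S`
eventually colors all vertices. -/
def IsKForcingSet {V : Type*} [Fintype V] [DecidableEq V] (G : SimpleGraph V)
    [DecidableRel G.Adj] (k : ℕ) (S : Finset V) : Prop :=
  (kForceStep G k)^[Fintype.card V] S = Finset.univ

/-- The `k`-forcing number: the minimum cardinality of a `k`-forcing set. -/
noncomputable def kForcingNumber {V : Type*} [Fintype V] [DecidableEq V] (G : SimpleGraph V)
    [DecidableRel G.Adj] (k : ℕ) : ℕ :=
  sInf {m | ∃ S : Finset V, IsKForcingSet G k S ∧ S.card = m}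

section Forcing

variable {V : Type*} [Fintype V] [DecidableEq V] (G : SimpleGraph V) [DecidableRel G.Adj]

theorem subset_kForceStep (k : ℕ) (C : Finset V) : C ⊆ kForceStep G k C :=
  subset_union_left

theorem kForceStep_mono (k : ℕ) : Monotone (kForceStep G k) := by
  intro C C' h
  refine union_subset_union h fun w hw => ?_
  simp only [mem_filter, mem_univ, true_and] at hw ⊢
  obtain ⟨v, hv, hvw, hcard⟩ := hw
  exact ⟨v, h hv, hvw, (card_le_card (sdiff_subset_sdiff Subset.rfl h)).trans hcard⟩

theorem isKForcingSet_of_iterate_eq_univ {k m : ℕ} {S : Finset V} (hm : m ≤ Fintype.card V)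
    (h : (kForceStep G k)^[m] S = univ) : IsKForcingSet G k S := by
  rw [IsKForcingSet, ← univ_subset_iff, ← h]
  exact Function.monotone_iterate_of_id_le (subset_kForceStep G k) hm S

/-- If no vertex is isolated, then outside any set `D` there is a set `Y` of at least
`|Dᶜ| / (Δ + 1)` vertices whose complement forces `Y` within `|Y|` rounds. -/
theorem exists_iterate_kForceStep_compl_eq_univ (hG : ∀ w, ∃ v, G.Adj w v) (D : Finset V) :
    ∃ Y : Finset V, Disjoint Y D ∧ #Dᶜ ≤ (G.maxDegree + 1) * #Y ∧
      (kForceStep G 1)^[#Y] Yᶜ = univ := by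
  induction h : #Dᶜ using Nat.strong_induction_on generalizing D with
  | _ m ih =>
  subst h
  obtain hD | ⟨w, hw⟩ := Dᶜ.eq_empty_or_nonempty
  · exact ⟨∅, by simp, by simp [hD], by simp⟩
  obtain ⟨v, hwv⟩ := hG w
  set N := insert v (G.neighborFinset v) with hN
  have hwN : w ∈ N := by simp [hN, hwv.symm]
  have hlt : #(D ∪ N)ᶜ < #Dᶜ := by
    refine card_lt_card ((ssubset_iff_of_subset (compl_subset_compl.2 subset_union_left)).2
      ⟨w, hw, ?_⟩)
    simp [hwN]
  obtain ⟨Y, hYD, hcard, hY⟩ := ih _ hlt (D ∪ N) rfl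
  rw [disjoint_union_right] at hYD
  have hwY : w ∉ Y := disjoint_right.1 hYD.2 hwN
  have hvY : v ∉ Y := disjoint_right.1 hYD.2 (mem_insert_self _ _)
  refine ⟨insert w Y, disjoint_insert_left.2 ⟨mem_compl.1 hw, hYD.1⟩, ?_, ?_⟩
  · have hNcard : #N ≤ G.maxDegree + 1 := by
      refine (card_insert_le _ _).trans (Nat.add_le_add_right ?_ 1)
      exact (G.card_neighborFinset_eq_degree v).trans_le (G.degree_le_maxDegree v)
    have hsub : Dᶜ ⊆ (D ∪ N)ᶜ ∪ N := by
      intro x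
      simp only [mem_union, mem_compl]
      tauto
    have := (card_le_card hsub).trans (card_union_le _ _)
    rw [card_insert_of_notMem hwY, mul_add_one]
    omega
  · rw [card_insert_of_notMem hwY, Function.iterate_succ_apply, ← univ_subset_iff, ← hY]
    refine (kForceStep_mono G 1).iterate _ fun x hx => ?_
    by_cases hxw : x = w
    · subst hxw
      refine mem_union_right _ (mem_filter.2 ⟨mem_univ _, v, ?_, hwv.symm, ?_⟩)
      · simp [hvY, hwv.ne.symm]
      · refine (card_le_card (t := {x}) fun y hy => ?_).trans (card_singleton x).le
        simp only [mem_sdiff, mem_compl, not_not, mem_insert] at hy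
        rw [mem_singleton]
        exact hy.2.resolve_right (disjoint_right.1 hYD.2 (mem_insert_of_mem hy.1))
    · refine subset_kForceStep G 1 _ ?_
      simpa [hxw] using hx

end Forcing

/-- Corollary: If `G` has minimum degree `δ ≥ 1`, then the zero forcing
number satisfies `Z(G) = F_1(G) ≤ Δ n / (Δ + 1)`. -/
theorem zeroForcingNumber_le {V : Type*} [Fintype V] [DecidableEq V]
    (G : SimpleGraph V) [DecidableRel G.Adj] (hδ : 1 ≤ G.minDegree) :
    (kForcingNumber G 1 : ℝ) ≤
      (G.maxDegree : ℝ) * (Fintype.card V) / ((G.maxDegree : ℝ) + 1) := by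
  have hG : ∀ w, ∃ v, G.Adj w v := fun w =>
    (G.degree_pos_iff_exists_adj w).1 (hδ.trans (G.minDegree_le_degree w))
  obtain ⟨Y, -, hcard, hY⟩ := exists_iterate_kForceStep_compl_eq_univ G hG ∅
  have hle : kForcingNumber G 1 ≤ #Yᶜ :=
    Nat.sInf_le ⟨Yᶜ, isKForcingSet_of_iterate_eq_univ G (card_le_univ Y) hY, rfl⟩
  rw [compl_empty, card_univ] at hcard
  have hsum : (#Y : ℝ) + #Yᶜ = Fintype.card V := mod_cast card_add_card_compl Y
  have hle' : (kForcingNumber G 1 : ℝ) ≤ #Yᶜ := mod_cast hle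
  have hcard' : (Fintype.card V : ℝ) ≤ (G.maxDegree + 1) * #Y := mod_cast hcard
  refine hle'.trans ?_
  rw [le_div_iff₀ (by positivity)]
  nlinarith
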